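/- For the metric g determined by the real constants a, b, p, q, s, the Ricci tensor has ρ₄₄ = −(a + b)x⁴ − (s + p) as its only (possibly) nonzero component: ρ_{jl} = 0 for all (j,l) ≠ (4,4). -/

import Mathlib

noncomputable section

open scoped BigOperators

/-- The metric of a four-dimensional two-symmetric Lorentzian manifold, in
coordinates `x 0 = x¹, x 1 = x², x 2 = x³, x 3 = x⁴`:
`g₁₄ = g₄₁ = g₂₂ = g₃₃ = 1`,
`g₄₄ = x⁴(a(x²)² + b(x³)²) + p(x²)² + 2q x²x³ + s(x³)²`, all others zero. -/
def gmat (a b p q s : ℝ) (x : Fin 4 → ℝ) : Matrix (Fin 4) (Fin 4) ℝ :=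
  Matrix.of fun i j =>
    if i = 0 ∧ j = 3 then 1
    else if i = 3 ∧ j = 0 then 1
    else if i = 1 ∧ j = 1 then 1
    else if i = 2 ∧ j = 2 then 1
    else if i = 3 ∧ j = 3 then
      x 3 * (a * (x 1) ^ 2 + b * (x 2) ^ 2) + p * (x 1) ^ 2
        + 2 * q * x 1 * x 2 + s * (x 2) ^ 2
    else 0

/-- The inverse matrix `g^{ij}`. -/
def ginv (a b p q s : ℝ) (x : Fin 4 → ℝ) : Matrix (Fin 4) (Fin 4) ℝ :=
  (gmat a b p q s x)⁻¹

/-- Partial derivative `∂_i` of a function on ℝ⁴. -/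
def pd (i : Fin 4) (f : (Fin 4 → ℝ) → ℝ) (x : Fin 4 → ℝ) : ℝ :=
  fderiv ℝ f x (Pi.single i 1)

/-- Christoffel symbols `Γ^k_{ij} = (1/2) Σ_l g^{kl}(∂_i g_{jl} + ∂_j g_{il} − ∂_l g_{ij})`. -/
def Gam (a b p q s : ℝ) (k i j : Fin 4) (x : Fin 4 → ℝ) : ℝ :=
  (1 / 2) * ∑ l, ginv a b p q s x k l *
    (pd i (fun y => gmat a b p q s y j l) x
      + pd j (fun y => gmat a b p q s y i l) x
      - pd l (fun y => gmat a b p q s y i j) x)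

/-- Curvature tensor
`R^i_{jkl} = ∂_k Γ^i_{lj} − ∂_l Γ^i_{kj} + Σ_m (Γ^i_{km} Γ^m_{lj} − Γ^i_{lm} Γ^m_{kj})`. -/
def Riem (a b p q s : ℝ) (i j k l : Fin 4) (x : Fin 4 → ℝ) : ℝ :=
  pd k (Gam a b p q s i l j) x - pd l (Gam a b p q s i k j) x
    + ∑ m, (Gam a b p q s i k m x * Gam a b p q s m l j x
      - Gam a b p q s i l m x * Gam a b p q s m k j x)

/-- Ricci tensor `ρ_{jl} = Σ_i R^i_{jil}`. -/
def Ric (a b p q s : ℝ) (j l : Fin 4) (x : Fin 4 → ℝ) : ℝ :=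
  ∑ i, Riem a b p q s i j i l x

/-- The component `g₄₄` of the metric. -/
def waveProfile (a b p q s : ℝ) (x : Fin 4 → ℝ) : ℝ :=
  x 3 * (a * (x 1) ^ 2 + b * (x 2) ^ 2) + p * (x 1) ^ 2 + 2 * q * x 1 * x 2 + s * (x 2) ^ 2

/-- The gradient of `waveProfile`. -/
def waveGrad (a b p q s : ℝ) (i : Fin 4) (x : Fin 4 → ℝ) : ℝ :=
  ![0, 2 * (a * x 3 + p) * x 1 + 2 * q * x 2, 2 * (b * x 3 + s) * x 2 + 2 * q * x 1,
    a * (x 1) ^ 2 + b * (x 2) ^ 2] i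

lemma pd_eq_of_hasDerivAt {f : (Fin 4 → ℝ) → ℝ} {x : Fin 4 → ℝ} {i : Fin 4} {c : ℝ}
    (hf : DifferentiableAt ℝ f x)
    (h : HasDerivAt (fun t : ℝ => f (x + t • Pi.single i 1)) c 0) : pd i f x = c := by
  rw [pd, ← hf.lineDeriv_eq_fderiv]
  exact HasLineDerivAt.lineDeriv h

lemma pd_const (i : Fin 4) (c : ℝ) (x : Fin 4 → ℝ) : pd i (fun _ => c) x = 0 := by
  simp [pd]

lemma pd_waveProfile (a b p q s : ℝ) (i : Fin 4) (x : Fin 4 → ℝ) :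
    pd i (waveProfile a b p q s) x = waveGrad a b p q s i x := by
  have hd : DifferentiableAt ℝ (waveProfile a b p q s) x := by
    unfold waveProfile
    fun_prop
  have h (j : Fin 4) : HasDerivAt (fun t : ℝ => x j + t * (Pi.single i 1 : Fin 4 → ℝ) j)
      ((Pi.single i 1 : Fin 4 → ℝ) j) 0 := by
    simpa using ((hasDerivAt_id (0 : ℝ)).mul_const _).const_add (x j)
  refine pd_eq_of_hasDerivAt hd ?_
  have key := ((((h 3).fun_mul ((((h 1).fun_pow 2).const_mul a).fun_add
    (((h 2).fun_pow 2).const_mul b))).fun_add (((h 1).fun_pow 2).const_mul p)).fun_add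
    (((h 1).const_mul (2 * q)).fun_mul (h 2))).fun_add (((h 2).fun_pow 2).const_mul s)
  refine (key.congr_deriv ?_).congr_of_eventuallyEq (.of_forall fun t => rfl)
  fin_cases i <;> simp [waveGrad] <;> ring

lemma pd_gmat (a b p q s : ℝ) (i j l : Fin 4) (x : Fin 4 → ℝ) :
    pd i (fun y => gmat a b p q s y j l) x =
      if j = 3 ∧ l = 3 then waveGrad a b p q s i x else 0 := by
  rw [← pd_waveProfile]
  fin_cases j <;> fin_cases l <;> simp [gmat, pd_const]
  rfl

lemma ginv_eq (a b p q s : ℝ) (x : Fin 4 → ℝ) :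
    ginv a b p q s x =
      !![-waveProfile a b p q s x, 0, 0, 1; 0, 1, 0, 0; 0, 0, 1, 0; 1, 0, 0, 0] := by
  refine Matrix.inv_eq_right_inv ?_
  ext i j
  fin_cases i <;> fin_cases j <;>
    simp [gmat, Matrix.mul_apply, Fin.sum_univ_four, waveProfile]
  ring

lemma Gam_eq (a b p q s : ℝ) (k i j : Fin 4) :
    Gam a b p q s k i j = fun x =>
      if k = 0 then
        if j = 3 then waveGrad a b p q s i x / 2
        else if i = 3 then waveGrad a b p q s j x / 2 else 0
      else if k ≠ 3 ∧ i = 3 ∧ j = 3 then -waveGrad a b p q s k x / 2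
      else 0 := by
  funext x
  simp only [Gam, pd_gmat, ginv_eq, Fin.sum_univ_four]
  fin_cases k <;> fin_cases i <;> fin_cases j <;> simp [waveGrad] <;> ring

lemma pd_one_waveGrad (a b p q s : ℝ) (x : Fin 4 → ℝ) :
    pd 1 (fun y => -waveGrad a b p q s 1 y / 2) x = -(a * x 3 + p) := by
  refine pd_eq_of_hasDerivAt (by simp only [waveGrad]; simp; fun_prop) ?_
  have key := ((hasDerivAt_id (0 : ℝ)).mul_const (-(a * x 3 + p))).const_add
    (-((a * x 3 + p) * x 1 + q * x 2))
  refine (key.congr_deriv (one_mul _)).congr_of_eventuallyEq (.of_forall fun t => ?_)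
  simp [waveGrad]
  ring

lemma pd_two_waveGrad (a b p q s : ℝ) (x : Fin 4 → ℝ) :
    pd 2 (fun y => -waveGrad a b p q s 2 y / 2) x = -(b * x 3 + s) := by
  refine pd_eq_of_hasDerivAt (by simp only [waveGrad]; simp; fun_prop) ?_
  have key := ((hasDerivAt_id (0 : ℝ)).mul_const (-(b * x 3 + s))).const_add
    (-((b * x 3 + s) * x 2 + q * x 1))
  refine (key.congr_deriv (one_mul _)).congr_of_eventuallyEq (.of_forall fun t => ?_)
  simp [waveGrad]
  ring

lemma Gam_trace (a b p q s : ℝ) (i j : Fin 4) : Gam a b p q s i i j = fun _ => 0 := by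
  rw [Gam_eq]
  funext x
  fin_cases i <;> fin_cases j <;> simp [waveGrad]

lemma pd_zero_waveGrad_div (a b p q s : ℝ) (j : Fin 4) (x : Fin 4 → ℝ) :
    pd 0 (fun y => waveGrad a b p q s j y / 2) x = 0 := by
  refine pd_eq_of_hasDerivAt (by fin_cases j <;> simp [waveGrad] <;> fun_prop) ?_
  refine (hasDerivAt_const (0 : ℝ) (waveGrad a b p q s j x / 2)).congr_of_eventuallyEq
    (.of_forall fun t => ?_)
  simp [waveGrad]

lemma pd_Gam_diag (a b p q s : ℝ) (i j l : Fin 4) (x : Fin 4 → ℝ) :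
    pd i (Gam a b p q s i l j) x =
      if l = 3 ∧ j = 3 then ![0, -(a * x 3 + p), -(b * x 3 + s), 0] i else 0 := by
  rw [Gam_eq]
  fin_cases i
  · by_cases hj : j = 3 <;> by_cases hl : l = 3 <;>
      simp [hj, hl, pd_zero_waveGrad_div, pd_const]
  · by_cases h : l = 3 ∧ j = 3 <;> simp [h, pd_one_waveGrad, pd_const]
  · by_cases h : l = 3 ∧ j = 3 <;> simp [h, pd_two_waveGrad, pd_const]
  · simp [pd_const]

lemma sum_Gam_mul_Gam (a b p q s : ℝ) (j l : Fin 4) (x : Fin 4 → ℝ) :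
    ∑ i, ∑ m, Gam a b p q s i l m x * Gam a b p q s m i j x = 0 := by
  simp only [Gam_eq, Fin.sum_univ_four]
  fin_cases j <;> fin_cases l <;> simp [waveGrad]

/-- the Ricci tensor has `ρ₄₄ = −(a + b)x⁴ − (s + p)` as its only
(possibly) nonzero component. -/
theorem ricci_of_two_symmetric (a b p q s : ℝ) (x : Fin 4 → ℝ) (j l : Fin 4) :
    Ric a b p q s j l x =
      if j = 3 ∧ l = 3 then -(a + b) * x 3 - (s + p) else 0 := by
  simp only [Ric, Riem, Finset.sum_add_distrib, Finset.sum_sub_distrib, sum_Gam_mul_Gam,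
    Gam_trace, pd_const, pd_Gam_diag]
  by_cases h : j = 3 ∧ l = 3
  · simp [h, Fin.sum_univ_four]
    ring
  · simp [h, and_comm]
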